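/- arXiv:2505.11490 — 12 statements merged into one kernel-verified Lean document; each statement's English description precedes it below -/
import Mathlib

section
/- Let L' be a first-order language with no relation symbols, M an L'-structure equipped with the discrete topology, and A any L'-structure. Endow the set H of all L'-homomorphisms from A to M with the subspace topology inherited from the product topology on (A → M). Then H is compact if and only if for every a ∈ A the set {h a | h ∈ H} is finite; moreover, whenever H is compact it is a Stone space (compact, Hausdorff and totally disconnected). -/
open FirstOrder Language Structure

/-- The pointwise `L`-structure on a function type `X → M`. -/
instance piStructure {L : FirstOrder.Language} {X M : Type*} [L.Structure M] :
    L.Structure (X → M) where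
  funMap f v x := funMap f fun i => v i x
  RelMap r v := ∀ x, RelMap r fun i => v i x

/-- For an algebraic language, a function is a homomorphism iff it commutes with the function
symbols. -/
theorem FirstOrder.Language.Hom.range_coe_eq_setOf {L : FirstOrder.Language} [L.IsAlgebraic]
    {M A : Type*} [L.Structure M] [L.Structure A] :
    Set.range (fun h : A →[L] M => (h : A → M)) =
      {g | ∀ (n : ℕ) (f : L.Functions n) (v : Fin n → A),
        g (funMap f v) = funMap f fun i => g (v i)} := by
  ext g
  constructor
  · rintro ⟨h, rfl⟩ n f v
    exact h.map_fun f v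
  · intro hg
    exact ⟨⟨g, fun f v => hg _ f v, fun r => isEmptyElim r⟩, rfl⟩

/-- For an algebraic language, the homomorphisms into a discrete structure form a closed subset of
the function space. -/
theorem FirstOrder.Language.Hom.isClosed_range_coe {L : FirstOrder.Language} [L.IsAlgebraic]
    {M A : Type*} [L.Structure M] [L.Structure A] [TopologicalSpace M] [DiscreteTopology M] :
    IsClosed (Set.range (fun h : A →[L] M => (h : A → M))) := by
  rw [range_coe_eq_setOf]
  simp only [Set.ofPred_forall]
  refine isClosed_iInter fun n => isClosed_iInter fun f => isClosed_iInter fun v => ?_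
  have hf : Continuous (funMap f : (Fin n → M) → M) := continuous_of_discreteTopology
  exact isClosed_eq (continuous_apply _) (hf.comp (by fun_prop))

/-- For an algebraic language `L`, an `L`-structure `M` with the discrete
topology and any `L`-structure `A`, the set `H` of homomorphisms `A → M`, with the
subspace topology of the product topology on `A → M`, is compact iff every
`{h a | h ∈ H}` is finite; moreover whenever `H` is compact it is a Stone space. -/
theorem stmt0 {L : FirstOrder.Language} [L.IsAlgebraic] {M A : Type*}
    [L.Structure M] [L.Structure A] [TopologicalSpace M] [DiscreteTopology M] :
    (IsCompact (Set.range (fun h : A →[L] M => (h : A → M))) ↔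
      ∀ a : A, (Set.range fun h : A →[L] M => h a).Finite) ∧
    (IsCompact (Set.range (fun h : A →[L] M => (h : A → M))) →
      CompactSpace (Set.range (fun h : A →[L] M => (h : A → M))) ∧
      T2Space (Set.range (fun h : A →[L] M => (h : A → M))) ∧
      TotallyDisconnectedSpace (Set.range (fun h : A →[L] M => (h : A → M)))) := by
  refine ⟨⟨fun hc a => ?_, fun hfin => ?_⟩, fun hc =>
    ⟨isCompact_iff_compactSpace.mp hc, inferInstance, inferInstance⟩⟩
  · have := (hc.image (continuous_apply a)).finite_of_discrete
    rwa [← Set.range_comp] at this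
  · refine (isCompact_univ_pi fun a => (hfin a).isCompact).of_isClosed_subset
      FirstOrder.Language.Hom.isClosed_range_coe ?_
    rintro _ ⟨h, rfl⟩ a -
    exact ⟨h, rfl⟩
end

section
/- Let L' be a first-order language with no relation symbols, M an L'-structure, and A an L'-structure. The following are equivalent: (i) [Jónsson property for finite covers] for every type X, every L'-embedding ρ : A ↪ (X → M) such that every ρ a has finite range, every finite family of subsets X₁, …, Xₙ of X (n ≥ 0) with X₁ ∪ … ∪ Xₙ = X, and every L'-homomorphism h : A → M, there exists i ∈ {1, …, n} such that for all a, b ∈ A, if ρ a and ρ b agree at every point of Xᵢ then h a = h b; (ii) [compact Jónsson property] for every compact topological space X, every L'-embedding ρ : A ↪ (X → M) such that every ρ a is continuous (M discrete), and every L'-homomorphism h : A → M, there exists x ∈ X such that for all a, b ∈ A, ρ a x = ρ b x implies h a = h b; (iii) [ultrafilter Jónsson property] for every type X, every L'-embedding ρ : A ↪ (X → M) such that every ρ a has finite range, and every L'-homomorphism h : A → M, there exists an ultrafilter U on X such that for all a, b ∈ A, {x | ρ a x = ρ b x} ∈ U implies h a = h b. -/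
open FirstOrder Language Structure

universe u v w

/-- A function with finite range is constant on some member of any ultrafilter. -/
theorem Ultrafilter.exists_fiber_mem_of_finite_range {X M : Type*} (U : Ultrafilter X)
    {f : X → M} (hf : (Set.range f).Finite) : ∃ m, {x | f x = m} ∈ U := by
  have hU : (⋃ m ∈ Set.range f, {x | f x = m}) ∈ U := by
    have hcover : (⋃ m ∈ Set.range f, {x | f x = m}) = Set.univ := by
      ext x
      simp
    exact hcover ▸ Filter.univ_mem (f := (U : Filter X))
  obtain ⟨m, -, hm⟩ := (Ultrafilter.finite_biUnion_mem_iff hf).1 hU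
  exact ⟨m, hm⟩

/-- The value that a function with finite range takes on a member of an ultrafilter. -/
noncomputable def Ultrafilter.limitValue {X M : Type*} (U : Ultrafilter X)
    {f : X → M} (hf : (Set.range f).Finite) : M :=
  (U.exists_fiber_mem_of_finite_range hf).choose

theorem Ultrafilter.limitValue_eq_iff {X M : Type*} (U : Ultrafilter X)
    {f : X → M} (hf : (Set.range f).Finite) {m : M} :
    U.limitValue hf = m ↔ {x | f x = m} ∈ U := by
  have hmem : {x | f x = U.limitValue hf} ∈ U :=
    (U.exists_fiber_mem_of_finite_range hf).choose_spec
  refine ⟨fun h => h ▸ hmem, fun h => ?_⟩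
  obtain ⟨x, hx, hx'⟩ := U.nonempty_of_mem (Filter.inter_mem hmem h)
  exact hx.symm.trans hx'

theorem Ultrafilter.limitValue_eq_limitValue_iff {X M : Type*} (U : Ultrafilter X)
    {f g : X → M} (hf : (Set.range f).Finite) (hg : (Set.range g).Finite) :
    U.limitValue hf = U.limitValue hg ↔ {x | f x = g x} ∈ U := by
  have hmem := (U.limitValue_eq_iff hg).1 rfl
  rw [limitValue_eq_iff]
  constructor <;> intro h <;> filter_upwards [h, hmem] with x hx hx'
  · exact hx.trans hx'.symm
  · exact hx.trans hx'

theorem Ultrafilter.continuous_limitValue {X M : Type*} [TopologicalSpace M] [DiscreteTopology M]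
    {f : X → M} (hf : (Set.range f).Finite) :
    Continuous fun U : Ultrafilter X => U.limitValue hf := by
  refine continuous_discrete_rng.2 fun m => ?_
  convert ultrafilter_isOpen_basic {x | f x = m} using 1
  ext U
  exact U.limitValue_eq_iff hf

/-- An embedding into `X → M` by functions with finite range extends to an embedding into
`Ultrafilter X → M`. -/
noncomputable def FirstOrder.Language.Embedding.ultrafilterExtend
    {L : FirstOrder.Language} [L.IsAlgebraic] {X M A : Type*} [L.Structure M] [L.Structure A]
    (ρ : A ↪[L] (X → M)) (hρ : ∀ a, (Set.range (ρ a)).Finite) :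
    A ↪[L] (Ultrafilter X → M) where
  toFun a U := U.limitValue (hρ a)
  inj' a b hab := by
    refine ρ.injective (funext fun x => ?_)
    exact (Ultrafilter.limitValue_eq_limitValue_iff (pure x) (hρ a) (hρ b)).1 (congrFun hab _)
  map_fun' {n} f v := by
    funext U
    refine (U.limitValue_eq_iff _).2 ?_
    have hv : ∀ᶠ x in (U : Filter X), ∀ i, ρ (v i) x = U.limitValue (hρ (v i)) :=
      Filter.eventually_all.2 fun i => (U.limitValue_eq_iff (hρ (v i))).1 rfl
    filter_upwards [hv] with x hx
    rw [ρ.map_fun]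
    exact congrArg (funMap f) (funext hx)
  map_rel' {n} r := isEmptyElim r

/-- If every ultrafilter contains a member of the family `E`, then a finite subfamily of `E` covers `X`. -/
theorem Ultrafilter.exists_fin_iUnion_eq_univ {X ι : Type*} (E : ι → Set X)
    (hE : ∀ U : Ultrafilter X, ∃ i, E i ∈ U) :
    ∃ (n : ℕ) (k : Fin n → ι), (⋃ j, E (k j)) = Set.univ := by
  obtain ⟨t, ht⟩ := isCompact_univ.elim_finite_subcover
    (fun i => {U : Ultrafilter X | E i ∈ U}) (fun i => ultrafilter_isOpen_basic (E i))
    fun U _ => Set.mem_iUnion.2 (hE U)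
  refine ⟨t.card, fun j => t.equivFin.symm j, Set.eq_univ_of_forall fun x => ?_⟩
  obtain ⟨i, hi, hx⟩ := Set.mem_iUnion₂.1 (ht (Set.mem_univ (pure x)))
  exact Set.mem_iUnion.2 ⟨t.equivFin ⟨i, hi⟩, by simpa using hx⟩

/-- equivalence of the Jónsson property for finite covers, the compact
Jónsson property, and the ultrafilter Jónsson property. -/
theorem stmt2 {L : FirstOrder.Language} [L.IsAlgebraic] {M : Type v} {A : Type w}
    [L.Structure M] [L.Structure A] [TopologicalSpace M] [DiscreteTopology M] :
    -- (i) ↔ (ii)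
    ((∀ (X : Type u) (ρ : A ↪[L] (X → M)), (∀ a : A, (Set.range (ρ a)).Finite) →
        ∀ (n : ℕ) (Xs : Fin n → Set X), (⋃ i, Xs i) = Set.univ →
        ∀ h : A →[L] M, ∃ i : Fin n, ∀ a b : A,
          (∀ x ∈ Xs i, ρ a x = ρ b x) → h a = h b) ↔
      (∀ (X : Type u) [TopologicalSpace X] [CompactSpace X] (ρ : A ↪[L] (X → M)),
        (∀ a : A, Continuous (ρ a)) →
        ∀ h : A →[L] M, ∃ x : X, ∀ a b : A, ρ a x = ρ b x → h a = h b)) ∧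
    -- (ii) ↔ (iii)
    ((∀ (X : Type u) [TopologicalSpace X] [CompactSpace X] (ρ : A ↪[L] (X → M)),
        (∀ a : A, Continuous (ρ a)) →
        ∀ h : A →[L] M, ∃ x : X, ∀ a b : A, ρ a x = ρ b x → h a = h b) ↔
      (∀ (X : Type u) (ρ : A ↪[L] (X → M)), (∀ a : A, (Set.range (ρ a)).Finite) →
        ∀ h : A →[L] M, ∃ U : Ultrafilter X, ∀ a b : A,
          {x : X | ρ a x = ρ b x} ∈ U → h a = h b)) := by
  have finite_of_ultrafilter : (∀ (X : Type u) (ρ : A ↪[L] (X → M)),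
      (∀ a : A, (Set.range (ρ a)).Finite) → ∀ h : A →[L] M, ∃ U : Ultrafilter X, ∀ a b : A,
        {x : X | ρ a x = ρ b x} ∈ U → h a = h b) →
      ∀ (X : Type u) (ρ : A ↪[L] (X → M)), (∀ a : A, (Set.range (ρ a)).Finite) →
        ∀ (n : ℕ) (Xs : Fin n → Set X), (⋃ i, Xs i) = Set.univ →
        ∀ h : A →[L] M, ∃ i : Fin n, ∀ a b : A,
          (∀ x ∈ Xs i, ρ a x = ρ b x) → h a = h b := by
    intro H X ρ hρ n Xs hXs h
    obtain ⟨U, hU⟩ := H X ρ hρ h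
    have hmem : (⋃ i ∈ (Set.univ : Set (Fin n)), Xs i) ∈ U := by
      rw [Set.biUnion_univ, hXs]
      exact Filter.univ_mem (f := (U : Filter X))
    obtain ⟨i, -, hi⟩ := (Ultrafilter.finite_biUnion_mem_iff Set.finite_univ).1 hmem
    exact ⟨i, fun a b hab => hU a b (Filter.mem_of_superset hi hab)⟩
  have compact_of_ultrafilter : (∀ (X : Type u) (ρ : A ↪[L] (X → M)),
      (∀ a : A, (Set.range (ρ a)).Finite) → ∀ h : A →[L] M, ∃ U : Ultrafilter X, ∀ a b : A,
        {x : X | ρ a x = ρ b x} ∈ U → h a = h b) →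
      ∀ (X : Type u) [TopologicalSpace X] [CompactSpace X] (ρ : A ↪[L] (X → M)),
        (∀ a : A, Continuous (ρ a)) →
        ∀ h : A →[L] M, ∃ x : X, ∀ a b : A, ρ a x = ρ b x → h a = h b := by
    intro H X _ _ ρ hρ h
    obtain ⟨U, hU⟩ := H X ρ (fun a => (isCompact_range (hρ a)).finite_of_discrete) h
    refine ⟨U.lim, fun a b hab => hU a b (U.le_nhds_lim ?_)⟩
    have hopen : IsOpen {x | ρ a x = ρ b x} :=
      (isOpen_discrete {p : M × M | p.1 = p.2}).preimage ((hρ a).prodMk (hρ b))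
    exact hopen.mem_nhds hab
  have ultrafilter_of_finite : (∀ (X : Type u) (ρ : A ↪[L] (X → M)),
      (∀ a : A, (Set.range (ρ a)).Finite) →
        ∀ (n : ℕ) (Xs : Fin n → Set X), (⋃ i, Xs i) = Set.univ →
        ∀ h : A →[L] M, ∃ i : Fin n, ∀ a b : A,
          (∀ x ∈ Xs i, ρ a x = ρ b x) → h a = h b) →
      ∀ (X : Type u) (ρ : A ↪[L] (X → M)), (∀ a : A, (Set.range (ρ a)).Finite) →
        ∀ h : A →[L] M, ∃ U : Ultrafilter X, ∀ a b : A,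
          {x : X | ρ a x = ρ b x} ∈ U → h a = h b := by
    intro H X ρ hρ h
    by_contra! hcon
    obtain ⟨n, k, hk⟩ := Ultrafilter.exists_fin_iUnion_eq_univ
      (fun p : {p : A × A // h p.1 ≠ h p.2} => {x | ρ p.1.1 x = ρ p.1.2 x}) fun U => by
        obtain ⟨a, b, hab, hne⟩ := hcon U
        exact ⟨⟨(a, b), hne⟩, hab⟩
    obtain ⟨i, hi⟩ := H X ρ hρ n _ hk h
    exact (k i).2 (hi _ _ fun x hx => hx)
  have ultrafilter_of_compact : (∀ (X : Type u) [TopologicalSpace X] [CompactSpace X]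
      (ρ : A ↪[L] (X → M)), (∀ a : A, Continuous (ρ a)) →
        ∀ h : A →[L] M, ∃ x : X, ∀ a b : A, ρ a x = ρ b x → h a = h b) →
      ∀ (X : Type u) (ρ : A ↪[L] (X → M)), (∀ a : A, (Set.range (ρ a)).Finite) →
        ∀ h : A →[L] M, ∃ U : Ultrafilter X, ∀ a b : A,
          {x : X | ρ a x = ρ b x} ∈ U → h a = h b := by
    intro H X ρ hρ h
    obtain ⟨U, hU⟩ := H (Ultrafilter X) (ρ.ultrafilterExtend hρ)
      (fun a => Ultrafilter.continuous_limitValue (hρ a)) h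
    exact ⟨U, fun a b hab =>
      hU a b ((U.limitValue_eq_limitValue_iff (hρ a) (hρ b)).2 hab)⟩
  exact ⟨⟨fun H => compact_of_ultrafilter (ultrafilter_of_finite H),
      fun H => finite_of_ultrafilter (ultrafilter_of_compact H)⟩,
    ⟨ultrafilter_of_compact, compact_of_ultrafilter⟩⟩
end

section
/- Let X be a Stone space (compact, Hausdorff, totally disconnected), L a type, and A : X → Set L a family such that A x is nonempty for every x ∈ X and the set {x ∈ X | a ∈ A x} is open for every a ∈ L. Then: (a) for every x₀ ∈ X and every a ∈ A x₀ there exists a locally constant function f : X → L (equivalently, continuous for the discrete topology on L) with f x₀ = a and f z ∈ A z for all z ∈ X; (b) for all x ≠ y in X and all a ∈ A x, b ∈ A y, there exists a locally constant f : X → L with f x = a, f y = b, and f z ∈ A z for all z ∈ X. -/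
theorem IsLocallyConstant.piecewise {X L : Type*} [TopologicalSpace X] {U : Set X}
    [∀ x, Decidable (x ∈ U)] (hU : IsClopen U) {f g : X → L} (hf : IsLocallyConstant f)
    (hg : IsLocallyConstant g) : IsLocallyConstant (U.piecewise f g) := by
  rw [IsLocallyConstant.iff_eventually_eq] at *
  intro x
  by_cases hx : x ∈ U
  · filter_upwards [hf x, hU.isOpen.mem_nhds hx] with y hy hyU
    simp [hx, hyU, hy]
  · filter_upwards [hg x, hU.compl.isOpen.mem_nhds hx] with y hy hyU
    have hyU' : y ∉ U := hyU
    simp [hx, hyU', hy]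

section StoneSpace

variable {X L : Type*} [TopologicalSpace X] [CompactSpace X] [T2Space X]
  [TotallyDisconnectedSpace X] {A : X → Set L}

open Classical in
theorem exists_isLocallyConstant_forall_mem [Nonempty X] (hne : ∀ x, (A x).Nonempty)
    (hopen : ∀ a, IsOpen {x | a ∈ A x}) :
    ∃ f : X → L, IsLocallyConstant f ∧ ∀ z, f z ∈ A z := by
  have key : ∃ U : Set X, Set.univ ⊆ U ∧ IsClopen U ∧
      ∃ f : X → L, IsLocallyConstant f ∧ ∀ z ∈ U, f z ∈ A z := by
    refine isCompact_univ.induction_on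
      (p := fun s ↦ ∃ U : Set X, s ⊆ U ∧ IsClopen U ∧
        ∃ f : X → L, IsLocallyConstant f ∧ ∀ z ∈ U, f z ∈ A z) ?_ ?_ ?_ ?_
    · obtain ⟨x⟩ := ‹Nonempty X›
      exact ⟨∅, subset_rfl, isClopen_empty, fun _ ↦ (hne x).some, .const _, by simp⟩
    · rintro s t hst ⟨U, htU, hU⟩
      exact ⟨U, hst.trans htU, hU⟩
    · rintro s t ⟨U, hsU, hU, f, hf, hfA⟩ ⟨V, htV, hV, g, hg, hgA⟩
      refine ⟨U ∪ V, Set.union_subset_union hsU htV, hU.union hV, U.piecewise f g,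
        hf.piecewise hU hg, fun z hz ↦ ?_⟩
      by_cases hzU : z ∈ U
      · simpa [hzU] using hfA z hzU
      · simpa [hzU] using hgA z (hz.resolve_left hzU)
    · intro x _
      obtain ⟨a, ha⟩ := hne x
      obtain ⟨U, hU, hxU, hUA⟩ := compact_exists_isClopen_in_isOpen (hopen a) ha
      exact ⟨U, mem_nhdsWithin_of_mem_nhds (hU.isOpen.mem_nhds hxU), U, subset_rfl, hU,
        fun _ ↦ a, .const a, hUA⟩
  obtain ⟨U, hUniv, -, f, hf, hfA⟩ := key
  exact ⟨f, hf, fun z ↦ hfA z (hUniv (Set.mem_univ z))⟩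

open Classical in
/-- A locally constant selection can be modified near a point so as to take any prescribed
admissible value there. -/
theorem IsLocallyConstant.exists_eq_and_eqOn_compl (hopen : ∀ a, IsOpen {x | a ∈ A x})
    {f : X → L} (hf : IsLocallyConstant f) (hfA : ∀ z, f z ∈ A z) {x : X} {a : L}
    (ha : a ∈ A x) {V : Set X} (hV : IsOpen V) (hxV : x ∈ V) :
    ∃ g : X → L, IsLocallyConstant g ∧ g x = a ∧ Set.EqOn g f Vᶜ ∧ ∀ z, g z ∈ A z := by
  obtain ⟨U, hU, hxU, hUA⟩ :=
    compact_exists_isClopen_in_isOpen ((hopen a).inter hV) ⟨ha, hxV⟩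
  refine ⟨U.piecewise (fun _ ↦ a) f, (IsLocallyConstant.const a).piecewise hU hf,
    by simp [hxU], fun z hz ↦ ?_, fun z ↦ ?_⟩
  · exact Set.piecewise_eq_of_notMem _ _ _ fun hzU ↦ hz (hUA hzU).2
  · by_cases hz : z ∈ U
    · simpa [hz] using (hUA hz).1
    · simpa [hz] using hfA z

end StoneSpace


/-- extension of pointwise constraints to locally constant selections on a
Stone space. -/
theorem stmt4 {X L : Type*} [TopologicalSpace X] [CompactSpace X] [T2Space X]
    [TotallyDisconnectedSpace X] (A : X → Set L)
    (hne : ∀ x : X, (A x).Nonempty)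
    (hopen : ∀ a : L, IsOpen {x : X | a ∈ A x}) :
    -- (a)
    (∀ x₀ : X, ∀ a ∈ A x₀, ∃ f : X → L, IsLocallyConstant f ∧ f x₀ = a ∧
      ∀ z : X, f z ∈ A z) ∧
    -- (b)
    (∀ x y : X, x ≠ y → ∀ a ∈ A x, ∀ b ∈ A y, ∃ f : X → L, IsLocallyConstant f ∧
      f x = a ∧ f y = b ∧ ∀ z : X, f z ∈ A z) := by
  have exists_eq (x₀ : X) (a : L) (ha : a ∈ A x₀) :
      ∃ f : X → L, IsLocallyConstant f ∧ f x₀ = a ∧ ∀ z : X, f z ∈ A z := by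
    have : Nonempty X := ⟨x₀⟩
    obtain ⟨f, hf, hfA⟩ := exists_isLocallyConstant_forall_mem hne hopen
    obtain ⟨g, hg, hgx, -, hgA⟩ :=
      hf.exists_eq_and_eqOn_compl hopen hfA ha isOpen_univ (Set.mem_univ x₀)
    exact ⟨g, hg, hgx, hgA⟩
  refine ⟨exists_eq, fun x y hxy a ha b hb ↦ ?_⟩
  obtain ⟨f, hf, hfx, hfA⟩ := exists_eq x a ha
  obtain ⟨g, hg, hgy, hgf, hgA⟩ :=
    hf.exists_eq_and_eqOn_compl hopen hfA hb isOpen_compl_singleton (Ne.symm hxy)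
  exact ⟨g, hg, (hgf (by simp)).trans hfx, hgy, hgA⟩
end

section
/- Let k ≥ 2, let M be a type with a near-unanimity operation m of arity k+1, let X be a finite type, and let 𝒜 be a subdirect m-closed family of k-ary constraints on X. If 𝒜 has the k(k−1)-ary local extension property, then 𝒜 has the global extension property: for every subset I ⊆ X with at most k elements and every f : X → M compatible on I, there exists g : X → M compatible on all of X that agrees with f on I. -/
/-- `m` is a near-unanimity operation of arity `k+1`. -/
def IsNUOp {M : Type*} {k : ℕ} (m : (Fin (k + 1) → M) → M) : Prop :=
  ∀ (a : M) (v : Fin (k + 1) → M), (∃ j, ∀ i ≠ j, v i = a) → m v = a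

/-- `f` is compatible on `S` with the family of `k`-ary constraints `𝒜`:
it belongs to `𝒜 J` for every subset `J ⊆ S` with at most `k` elements. -/
def CompatOn {X M : Type*} (k : ℕ) (𝒜 : Finset X → Set (X → M)) (S : Set X)
    (f : X → M) : Prop :=
  ∀ J : Finset X, ↑J ⊆ S → J.card ≤ k → f ∈ 𝒜 J

open Classical in
/-- A Helly-type property: given a near-unanimity operation of arity `k+1`, the values at `j`
extending `f` over each member of a finite family of subsets have a common element, as soon as
this holds for all subfamilies with at most `k` members. -/
theorem exists_common_extension_value {M X : Type*} {k : ℕ} (hk : 2 ≤ k)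
    (m : (Fin (k + 1) → M) → M) (hm : IsNUOp m)
    (𝒜 : Finset X → Set (X → M))
    (hrestrict : ∀ I : Finset X, I.card ≤ k → ∀ f g : X → M,
      (∀ x ∈ I, f x = g x) → (f ∈ 𝒜 I ↔ g ∈ 𝒜 I))
    (hclosed : ∀ I : Finset X, I.card ≤ k → ∀ v : Fin (k + 1) → (X → M),
      (∀ i, v i ∈ 𝒜 I) → (fun x => m fun i => v i x) ∈ 𝒜 I)
    (hsub : ∀ I J : Finset X, J ⊆ I → I.card ≤ k →
      𝒜 I ⊆ 𝒜 J ∧ ∀ f ∈ 𝒜 J, ∃ g ∈ 𝒜 I, ∀ x ∈ J, f x = g x)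
    (f : X → M) (j : X) (P : Finset X → Prop)
    (hcard : ∀ J, P J → (insert j J).card ≤ k)
    (hsmall : ∀ 𝒢 : Finset (Finset X), 𝒢.card ≤ k → (∀ J ∈ 𝒢, P J) →
      ∃ b, ∀ J ∈ 𝒢, Function.update f j b ∈ 𝒜 (insert j J))
    (𝒢 : Finset (Finset X)) (h𝒢 : ∀ J ∈ 𝒢, P J) :
    ∃ b, ∀ J ∈ 𝒢, Function.update f j b ∈ 𝒜 (insert j J) := by
  induction 𝒢 using Finset.strongInduction with
  | H 𝒢 ih =>
    rcases le_or_gt 𝒢.card k with h | h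
    · exact hsmall 𝒢 h h𝒢
    obtain ⟨e⟩ : Nonempty (Fin (k + 1) ↪ 𝒢) :=
      Function.Embedding.nonempty_of_card_le (by simpa using h)
    have key (i : Fin (k + 1)) : ∃ b, ∀ J ∈ 𝒢.erase (e i),
        Function.update f j b ∈ 𝒜 (insert j J) :=
      ih _ (Finset.erase_ssubset (e i).2) fun J hJ => h𝒢 J (Finset.mem_of_mem_erase hJ)
    choose b hb using key
    have hw (i : Fin (k + 1)) (J : Finset X) (hJ : J ∈ 𝒢) :
        ∃ w ∈ 𝒜 (insert j J), w j = b i ∧ (J ≠ e i → w = Function.update f j (b i)) := by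
      by_cases hJi : J = e i
      · obtain ⟨J', hJ'⟩ : (𝒢.erase (e i)).Nonempty := by
          rw [← Finset.card_pos, Finset.card_erase_of_mem (e i).2]
          omega
        have hj := (hsub (insert j J') {j} (by simp)
          (hcard J' (h𝒢 J' (Finset.mem_of_mem_erase hJ')))).1 (hb i J' hJ')
        obtain ⟨w, hw, hwj⟩ := (hsub (insert j J) {j} (by simp) (hcard J (h𝒢 J hJ))).2 _ hj
        refine ⟨w, hw, ?_, fun h => absurd hJi h⟩
        simpa using (hwj j (by simp)).symm
      · exact ⟨_, hb i J (Finset.mem_erase.2 ⟨hJi, hJ⟩), by simp, fun _ => rfl⟩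
    refine ⟨m b, fun J hJ => ?_⟩
    choose v hv hvj hvf using fun i => hw i J hJ
    refine (hrestrict _ (hcard J (h𝒢 J hJ)) _ _ fun x _ => ?_).1
      (hclosed _ (hcard J (h𝒢 J hJ)) v hv)
    by_cases hx : x = j
    · subst hx
      simp [hvj]
    · rw [Function.update_of_ne hx]
      apply hm
      by_cases hex : ∃ i, J = e i
      · obtain ⟨i, hi⟩ := hex
        refine ⟨i, fun l hl => ?_⟩
        rw [hvf l fun h => hl (e.injective (Subtype.ext (h.symm.trans hi))),
          Function.update_of_ne hx]
      · push Not at hex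
        refine ⟨0, fun l _ => ?_⟩
        rw [hvf l (hex l), Function.update_of_ne hx]

open Classical in
/-- With a near-unanimity operation of arity `k+1`, the `k(k-1)`-ary local extension property
implies one-point extension from arbitrary subsets of a finite type. -/
theorem exists_compatOn_union_singleton {M X : Type*} [Finite X] {k : ℕ} (hk : 2 ≤ k)
    (m : (Fin (k + 1) → M) → M) (hm : IsNUOp m)
    (𝒜 : Finset X → Set (X → M))
    (hrestrict : ∀ I : Finset X, I.card ≤ k → ∀ f g : X → M,
      (∀ x ∈ I, f x = g x) → (f ∈ 𝒜 I ↔ g ∈ 𝒜 I))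
    (hclosed : ∀ I : Finset X, I.card ≤ k → ∀ v : Fin (k + 1) → (X → M),
      (∀ i, v i ∈ 𝒜 I) → (fun x => m fun i => v i x) ∈ 𝒜 I)
    (hsub : ∀ I J : Finset X, J ⊆ I → I.card ≤ k →
      𝒜 I ⊆ 𝒜 J ∧ ∀ f ∈ 𝒜 J, ∃ g ∈ 𝒜 I, ∀ x ∈ J, f x = g x)
    (hloc : ∀ S : Set X, S.ncard ≤ k * (k - 1) → ∀ j : X, ∀ f : X → M,
      CompatOn k 𝒜 S f → ∃ g : X → M, CompatOn k 𝒜 (S ∪ {j}) g ∧ ∀ x ∈ S, g x = f x)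
    (S : Set X) (j : X) (f : X → M) (hf : CompatOn k 𝒜 S f) :
    ∃ g : X → M, CompatOn k 𝒜 (S ∪ {j}) g ∧ ∀ x ∈ S, g x = f x := by
  by_cases hjS : j ∈ S
  · exact ⟨f, by rwa [Set.union_eq_self_of_subset_right (by simpa using hjS)], fun _ _ => rfl⟩
  have := Fintype.ofFinite X
  have hcard (J : Finset X) (hJ : (J : Set X) ⊆ S ∧ J.card ≤ k - 1) :
      (insert j J).card ≤ k :=
    (Finset.card_insert_le j J).trans (by omega)
  obtain ⟨b, hb⟩ := exists_common_extension_value hk m hm 𝒜 hrestrict hclosed hsub f j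
    (fun J => (J : Set X) ⊆ S ∧ J.card ≤ k - 1) hcard
    (fun 𝒢 h𝒢 hP => by
      have hUS : ((𝒢.biUnion id : Finset X) : Set X) ⊆ S := by
        simpa using fun J hJ => (hP J hJ).1
      have hU : ((𝒢.biUnion id : Finset X) : Set X).ncard ≤ k * (k - 1) := by
        rw [Set.ncard_coe_finset]
        exact (Finset.card_biUnion_le_card_mul _ _ _ fun J hJ => (hP J hJ).2).trans
          (Nat.mul_le_mul_right _ h𝒢)
      obtain ⟨g, hg, hgf⟩ := hloc _ hU j f fun J hJ => hf J (hJ.trans hUS)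
      refine ⟨g j, fun J hJ => ?_⟩
      have hJU : J ⊆ 𝒢.biUnion id := Finset.subset_biUnion_of_mem id hJ
      refine (hrestrict _ (hcard J (hP J hJ)) _ _ fun x hx => ?_).1
        (hg (insert j J) ?_ (hcard J (hP J hJ)))
      · by_cases hxj : x = j
        · subst hxj
          simp
        · rw [Function.update_of_ne hxj]
          exact hgf x (hJU ((Finset.mem_insert.1 hx).resolve_left hxj))
      · rw [Finset.coe_insert, Set.union_singleton]
        exact Set.insert_subset_insert (Finset.coe_subset.2 hJU))
    (Finset.univ.filter fun J => (J : Set X) ⊆ S ∧ J.card ≤ k - 1) (by simp)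
  refine ⟨Function.update f j b, fun K hK hKk => ?_, fun x hx =>
    Function.update_of_ne (by rintro rfl; exact hjS hx) _ _⟩
  rw [Set.union_singleton] at hK
  by_cases hjK : j ∈ K
  · rw [← Finset.insert_erase hjK]
    apply hb
    simp only [Finset.mem_filter, Finset.mem_univ, true_and]
    refine ⟨?_, by rw [Finset.card_erase_of_mem hjK]; omega⟩
    rw [Finset.coe_erase]
    simpa [Set.sdiff_subset_iff] using hK
  · refine (hrestrict K hKk f _ fun x hx => ?_).1
      (hf K ((Set.subset_insert_iff_of_notMem (by simpa using hjK)).1 hK) hKk)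
    rw [Function.update_of_ne (by rintro rfl; exact hjK hx)]

/-- for a finite type `X` and a subdirect `m`-closed family of `k`-ary
constraints, the `k(k-1)`-ary local extension property implies the global extension
property. -/
theorem stmt5 {M X : Type*} [Finite X] {k : ℕ} (hk : 2 ≤ k)
    (m : (Fin (k + 1) → M) → M) (hm : IsNUOp m)
    (𝒜 : Finset X → Set (X → M))
    -- (1) membership in `𝒜 I` only depends on the restriction to `I`
    (hrestrict : ∀ I : Finset X, I.card ≤ k → ∀ f g : X → M,
      (∀ x ∈ I, f x = g x) → (f ∈ 𝒜 I ↔ g ∈ 𝒜 I))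
    -- (2) each `𝒜 I` is closed under pointwise application of `m`
    (hclosed : ∀ I : Finset X, I.card ≤ k → ∀ v : Fin (k + 1) → (X → M),
      (∀ i, v i ∈ 𝒜 I) → (fun x => m fun i => v i x) ∈ 𝒜 I)
    -- (3) subdirectness
    (hsub : ∀ I J : Finset X, J ⊆ I → I.card ≤ k →
      𝒜 I ⊆ 𝒜 J ∧ ∀ f ∈ 𝒜 J, ∃ g ∈ 𝒜 I, ∀ x ∈ J, f x = g x)
    -- `k(k-1)`-ary local extension property
    (hloc : ∀ S : Set X, S.ncard ≤ k * (k - 1) → ∀ j : X, ∀ f : X → M,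
      CompatOn k 𝒜 S f → ∃ g : X → M, CompatOn k 𝒜 (S ∪ {j}) g ∧ ∀ x ∈ S, g x = f x) :
    -- global extension property
    ∀ I : Finset X, I.card ≤ k → ∀ f : X → M, CompatOn k 𝒜 ↑I f →
      ∃ g : X → M, CompatOn k 𝒜 Set.univ g ∧ ∀ x ∈ I, g x = f x := by
  classical
  intro I _ f hf
  have := Fintype.ofFinite X
  have key (T : Finset X) : ∃ g : X → M, CompatOn k 𝒜 (↑I ∪ ↑T) g ∧ ∀ x ∈ I, g x = f x := by
    induction T using Finset.induction_on with
    | empty => exact ⟨f, by simpa using hf, fun _ _ => rfl⟩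
    | insert j T _ ih =>
      obtain ⟨g, hg, hgf⟩ := ih
      obtain ⟨g', hg', hgg'⟩ := exists_compatOn_union_singleton hk m hm 𝒜 hrestrict hclosed
        hsub hloc _ j g hg
      refine ⟨g', ?_, fun x hx => (hgg' x (Or.inl hx)).trans (hgf x hx)⟩
      rwa [Finset.coe_insert, Set.insert_eq, Set.union_comm {j}, ← Set.union_assoc]
  simpa using key Finset.univ
end

section
/- Let L' be a first-order language with no relation symbols, M an L'-structure, and k ≥ 2. Suppose there is an L'-term t in k+1 variables whose realization in M is a near-unanimity operation: for all a ∈ M and v : Fin (k+1) → M, if v i = a for all but at most one index i, then the realization of t at v equals a. Then M has the finite k-ary Baker–Pixley property: for every finite type X, every substructure A of (X → M) that separates the points of X, and every f : X → M, if for every subset I ⊆ X with at most k elements there is g ∈ A agreeing with f on I, then f ∈ A. -/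
open FirstOrder Language Structure

universe u v

theorem FirstOrder.Language.Term.realize_pi_apply {L : FirstOrder.Language} {X M α : Type*}
    [L.Structure M] (t : L.Term α) (v : α → X → M) (x : X) :
    t.realize v x = t.realize fun i => v i x := by
  induction t with
  | var _ => rfl
  | func f ts ih =>
    simp only [Term.realize_func, ← ih]
    rfl

/-- If a substructure of `X → M` interpolates `f` on all sets of at most `k` points and `M` has a
near-unanimity term in `k + 1` variables, then it interpolates `f` on all finite sets. -/
theorem FirstOrder.Language.Substructure.exists_mem_eqOn_of_nearUnanimity
    {L : FirstOrder.Language} {X M : Type*} [L.Structure M] {k : ℕ} (t : L.Term (Fin (k + 1)))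
    (ht : ∀ (a : M) (v : Fin (k + 1) → M), (∃ j, ∀ i ≠ j, v i = a) → t.realize v = a)
    (A : L.Substructure (X → M)) (f : X → M)
    (hf : ∀ I : Finset X, I.card ≤ k → ∃ g ∈ A, ∀ x ∈ I, f x = g x) (I : Finset X) :
    ∃ g ∈ A, ∀ x ∈ I, f x = g x := by
  classical
  induction I using Finset.strongInduction with
  | H I ih =>
    by_cases hI : I.card ≤ k
    · exact hf I hI
    obtain ⟨e⟩ : Nonempty (Fin (k + 1) ↪ I) :=
      Function.Embedding.nonempty_of_card_le (by simpa using hI)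
    choose g hgA hg using fun j => ih _ (Finset.erase_ssubset (e j).2)
    refine ⟨t.realize g, t.realize_mem g hgA, fun x hx => ?_⟩
    rw [Term.realize_pi_apply]
    refine (ht _ _ ?_).symm
    have key : ∀ i, (e i : X) ≠ x → g i x = f x := fun i hi =>
      (hg i x (Finset.mem_erase.2 ⟨hi.symm, hx⟩)).symm
    by_cases h : ∃ j, (e j : X) = x
    · obtain ⟨j, rfl⟩ := h
      exact ⟨j, fun i hij => key i fun h => hij (e.injective (Subtype.ext h))⟩
    · exact ⟨0, fun i _ => key i fun hi => h ⟨i, hi⟩⟩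

/-- if an algebraic language `L` has a term `t` in `k+1` variables whose
realization in `M` is a near-unanimity operation, then `M` has the finite `k`-ary
Baker–Pixley property. -/
theorem stmt6 {L : FirstOrder.Language} [L.IsAlgebraic] {M : Type v} [L.Structure M]
    (k : ℕ) (hk : 2 ≤ k) (t : L.Term (Fin (k + 1)))
    (ht : ∀ (a : M) (v : Fin (k + 1) → M), (∃ j, ∀ i ≠ j, v i = a) → t.realize v = a) :
    ∀ (X : Type u), Finite X → ∀ A : L.Substructure (X → M),
      (∀ x y : X, x ≠ y → ∃ g ∈ A, g x ≠ g y) →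
      ∀ f : X → M,
        (∀ I : Finset X, I.card ≤ k → ∃ g ∈ A, ∀ x ∈ I, f x = g x) → f ∈ A := by
  intro X _ A _ f hf
  cases nonempty_fintype X
  obtain ⟨g, hgA, hg⟩ := A.exists_mem_eqOn_of_nearUnanimity t ht f hf Finset.univ
  rwa [funext fun x => hg x (Finset.mem_univ x)]
end

section
/- Let L' be a first-order language with no relation symbols and M an L'-structure. Then M has the finite unary (k = 1) Baker–Pixley property if and only if M has the finite binary (k = 2) Baker–Pixley property and every substructure S of the pointwise L'-structure on (Fin 2 → M) is either contained in the diagonal {f | f 0 = f 1} or of the form {f | f 0 ∈ C₁ and f 1 ∈ C₂} for some substructures C₁, C₂ of M. -/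
open FirstOrder Language Structure

universe u v

/-- The finite `k`-ary Baker–Pixley property of an `L`-structure `M`. -/
def FiniteBP (L : FirstOrder.Language) (M : Type v) [L.Structure M] (k : ℕ) : Prop :=
  ∀ (X : Type u), Finite X → ∀ A : L.Substructure (X → M),
    (∀ x y : X, x ≠ y → ∃ g ∈ A, g x ≠ g y) →
    ∀ f : X → M,
      (∀ I : Finset X, I.card ≤ k → ∃ g ∈ A, ∀ x ∈ I, f x = g x) → f ∈ A

/-- Precomposition with `e : Y → X` as a homomorphism of pointwise structures. -/
def precompHom (L : FirstOrder.Language) {X Y M : Type*} [L.Structure M] (e : Y → X) :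
    L.Hom (X → M) (Y → M) where
  toFun g y := g (e y)
  map_fun' _ _ := rfl
  map_rel' _ _ h y := h (e y)

/-- Evaluation at a point as a homomorphism from the pointwise structure. -/
def evalHom (L : FirstOrder.Language) {X M : Type*} [L.Structure M] (x : X) :
    L.Hom (X → M) M where
  toFun g := g x
  map_fun' _ _ := rfl
  map_rel' _ _ h := h x

theorem FiniteBP.mono {L : FirstOrder.Language} {M : Type v} [L.Structure M] {k l : ℕ}
    (hkl : k ≤ l) (h : FiniteBP.{u} L M k) : FiniteBP.{u} L M l :=
  fun X hX A hA f hf => h X hX A hA f fun I hI => hf I (hI.trans hkl)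

theorem FiniteBP.substructure_fin_two {L : FirstOrder.Language} {M : Type v} [L.Structure M]
    (h : FiniteBP.{u} L M 1) (S : L.Substructure (Fin 2 → M)) (hS : ¬ ∀ f ∈ S, f 0 = f 1) :
    (S : Set (Fin 2 → M)) =
      {f : Fin 2 → M | f 0 ∈ S.map (evalHom L 0) ∧ f 1 ∈ S.map (evalHom L 1)} := by
  push Not at hS
  obtain ⟨s, hs, hne⟩ := hS
  ext f
  refine ⟨fun hf => ⟨⟨f, hf, rfl⟩, ⟨f, hf, rfl⟩⟩, ?_⟩
  rintro ⟨⟨g₀, hg₀, e₀⟩, ⟨g₁, hg₁, e₁⟩⟩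
  change g₀ 0 = f 0 at e₀
  change g₁ 1 = f 1 at e₁
  have key := h (ULift (Fin 2)) inferInstance (S.map (precompHom L ULift.down)) ?_
    (fun y => f y.down) ?_
  · obtain ⟨g, hg, e⟩ := key
    have hgf : g = f := funext fun i => congrFun e (ULift.up i)
    exact hgf ▸ hg
  · rintro ⟨x⟩ ⟨y⟩ hxy
    refine ⟨fun z => s z.down, ⟨s, hs, rfl⟩, ?_⟩
    fin_cases x <;> fin_cases y
    · exact absurd rfl hxy
    · exact hne
    · exact hne.symm
    · exact absurd rfl hxy
  · intro I hI
    have hpt : ∀ i : Fin 2, ∃ g ∈ S, f i = g i := by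
      intro i
      fin_cases i
      · exact ⟨g₀, hg₀, e₀.symm⟩
      · exact ⟨g₁, hg₁, e₁.symm⟩
    obtain ⟨⟨i⟩, hi⟩ := Finset.card_le_one_iff_subset_singleton.mp hI
    obtain ⟨g, hg, e⟩ := hpt i
    refine ⟨fun z => g z.down, ⟨g, hg, rfl⟩, fun x hx => ?_⟩
    rw [Finset.mem_singleton.mp (hi hx)]
    exact e

theorem FiniteBP.one_of_two {L : FirstOrder.Language} {M : Type v} [L.Structure M]
    (h : FiniteBP.{u} L M 2)
    (hS : ∀ S : L.Substructure (Fin 2 → M), (∀ f ∈ S, f 0 = f 1) ∨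
      ∃ C₁ C₂ : L.Substructure M,
        (S : Set (Fin 2 → M)) = {f : Fin 2 → M | f 0 ∈ C₁ ∧ f 1 ∈ C₂}) :
    FiniteBP.{u} L M 1 := by
  classical
  intro X hX A hA f hf
  refine h X hX A hA f fun I hI => ?_
  rcases Nat.lt_or_eq_of_le hI with hI | hI
  · exact hf I (by omega)
  obtain ⟨x, y, hxy, rfl⟩ := Finset.card_eq_two.mp hI
  have hpt : ∀ z, ∃ g ∈ A, f z = g z := fun z => by
    obtain ⟨g, hg, e⟩ := hf {z} (by simp)
    exact ⟨g, hg, e z (by simp)⟩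
  obtain ⟨gx, hgx, ex⟩ := hpt x
  obtain ⟨gy, hgy, ey⟩ := hpt y
  have hmem : ∀ g ∈ A, (fun i => g (![x, y] i)) ∈ A.map (precompHom L ![x, y]) :=
    fun g hg => ⟨g, hg, rfl⟩
  rcases hS (A.map (precompHom L ![x, y])) with hd | ⟨C₁, C₂, hC⟩
  · obtain ⟨g, hg, hne⟩ := hA x y hxy
    exact absurd (hd _ (hmem g hg)) hne
  · have hprod : ∀ p : Fin 2 → M,
        p ∈ A.map (precompHom L ![x, y]) ↔ p 0 ∈ C₁ ∧ p 1 ∈ C₂ := fun p => Set.ext_iff.mp hC p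
    have hfx : f x ∈ C₁ := ex ▸ ((hprod _).mp (hmem gx hgx)).1
    have hfy : f y ∈ C₂ := ey ▸ ((hprod _).mp (hmem gy hgy)).2
    obtain ⟨g, hg, e⟩ := (hprod ![f x, f y]).mpr ⟨hfx, hfy⟩
    refine ⟨g, hg, fun z hz => ?_⟩
    rcases Finset.mem_insert.mp hz with rfl | hz
    · exact (congrFun e 0).symm
    · rw [Finset.mem_singleton.mp hz]
      exact (congrFun e 1).symm


/-- `M` has the finite unary Baker–Pixley property iff it has the finite
binary Baker–Pixley property and every substructure of `Fin 2 → M` is either contained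
in the diagonal or a product of two substructures of `M`. -/
theorem stmt7 {L : FirstOrder.Language} [L.IsAlgebraic] {M : Type v} [L.Structure M] :
    FiniteBP.{u} L M 1 ↔
      (FiniteBP.{u} L M 2 ∧
        ∀ S : L.Substructure (Fin 2 → M),
          (∀ f ∈ S, f 0 = f 1) ∨
          ∃ C₁ C₂ : L.Substructure M,
            (S : Set (Fin 2 → M)) = {f : Fin 2 → M | f 0 ∈ C₁ ∧ f 1 ∈ C₂}) := by
  refine ⟨fun h => ⟨h.mono one_le_two, fun S => ?_⟩, fun h => h.1.one_of_two h.2⟩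
  exact or_iff_not_imp_left.mpr fun hS => ⟨_, _, h.substructure_fin_two S hS⟩
end

section
/- Let k ≥ 2, let M be a type with a near-unanimity operation m of arity k+1, let J be a type, y ∈ J, and let A be a set of functions J → M closed under pointwise application of m. Put A_y := {g y | g ∈ A}, and for a function f : J → M put M_f := {a ∈ A_y | there exists g ∈ A with g y = a and g x = f x for all x ≠ y}. Then M_f is convex in A_y with respect to m: for every v : Fin (k+1) → M with all values in A_y and with v i ∈ M_f for all but at most one index i, one has m v ∈ M_f. -/
/-- the set of values at `y` of members of `A` agreeing with `f` away
from `y` is convex in `A_y` with respect to the near-unanimity operation `m`. -/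
theorem stmt9 {M J : Type*} {k : ℕ} (hk : 2 ≤ k) (m : (Fin (k + 1) → M) → M)
    (hm : IsNUOp m) (y : J) (A : Set (J → M))
    (hA : ∀ v : Fin (k + 1) → (J → M), (∀ i, v i ∈ A) →
      (fun x => m fun i => v i x) ∈ A)
    (f : J → M) :
    ∀ v : Fin (k + 1) → M,
      (∀ i, v i ∈ {a : M | ∃ g ∈ A, g y = a}) →
      (∃ j, ∀ i ≠ j, v i ∈ {a : M | a ∈ {a : M | ∃ g ∈ A, g y = a} ∧
        ∃ g ∈ A, g y = a ∧ ∀ x ≠ y, g x = f x}) →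
      m v ∈ {a : M | a ∈ {a : M | ∃ g ∈ A, g y = a} ∧
        ∃ g ∈ A, g y = a ∧ ∀ x ≠ y, g x = f x} := by
  rintro v hv ⟨j, hj⟩
  have h : ∀ i, ∃ g ∈ A, g y = v i ∧ (i ≠ j → ∀ x ≠ y, g x = f x) := by
    intro i
    by_cases hij : i = j
    · obtain ⟨g, hg, hgy⟩ := hv i
      exact ⟨g, hg, hgy, fun hne => absurd hij hne⟩
    · obtain ⟨-, g, hg, hgy, hgf⟩ := hj i hij
      exact ⟨g, hg, hgy, fun _ => hgf⟩
  choose g hg hgy hgf using h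
  have hmy : (m fun i => g i y) = m v := congrArg m (funext hgy)
  exact ⟨⟨_, hA g hg, hmy⟩, _, hA g hg, hmy,
    fun x hx => hm (f x) _ ⟨j, fun i hi => hgf i hi x hx⟩⟩
end

section
/- Let L' be a first-order language with no relation symbols and M an L'-structure which is also a lattice with least element ⊥ and greatest element ⊤. Assume the bounded lattice operations are term operations of M: there are L'-terms in two variables whose realizations in M are the meet and the join, and L'-terms in one variable whose realizations are the constant functions with values ⊥ and ⊤. Assume further that for all a, b ∈ M with ¬(a ≤ b) there exists an L'-term t in one variable whose realization in M sends a to ⊤ and b to ⊥. Then for every substructure A of M, every L'-homomorphism h : A → M satisfies h a = a for all a ∈ A (M has only trivial partial endomorphisms). -/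
open FirstOrder Language

/-- An equality of terms that holds at a tuple of a substructure is preserved by every homomorphism
from that substructure. -/
theorem realize_hom_eq_of_realize_eq {L : FirstOrder.Language} {M N α : Type*} [L.Structure M]
    [L.Structure N] {A : L.Substructure M} (h : A →[L] N) {s t : L.Term α} {v : α → A}
    (hst : s.realize (fun i => (v i : M)) = t.realize (fun i => (v i : M))) :
    s.realize (fun i => h (v i)) = t.realize (fun i => h (v i)) := by
  have hA : s.realize v = t.realize v := Subtype.ext <|
    (HomClass.realize_term A.subtype).symm.trans (hst.trans (HomClass.realize_term A.subtype))
  exact (HomClass.realize_term h).trans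
    ((congrArg h hA).trans (HomClass.realize_term h).symm)

/-- if `M` is an `L`-structure and a bounded lattice whose bounded
lattice operations are term operations, and any `a ≰ b` are separated by a unary term
sending `a` to `⊤` and `b` to `⊥`, then `M` has only trivial partial endomorphisms. -/
theorem stmt11 {L : FirstOrder.Language} [L.IsAlgebraic] {M : Type*} [L.Structure M]
    [Lattice M] [BoundedOrder M]
    (tinf tsup : L.Term (Fin 2))
    (hinf : ∀ v : Fin 2 → M, tinf.realize v = v 0 ⊓ v 1)
    (hsup : ∀ v : Fin 2 → M, tsup.realize v = v 0 ⊔ v 1)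
    (tbot ttop : L.Term (Fin 1))
    (hbot : ∀ v : Fin 1 → M, tbot.realize v = ⊥)
    (htop : ∀ v : Fin 1 → M, ttop.realize v = ⊤)
    (hsep : ∀ a b : M, ¬a ≤ b → ∃ t : L.Term (Fin 1),
      t.realize (fun _ => a) = ⊤ ∧ t.realize (fun _ => b) = ⊥) :
    ∀ (A : L.Substructure M) (h : A →[L] M) (a : A), h a = ↑a := by
  intro A h a
  apply le_antisymm
  · by_contra hle
    obtain ⟨t, ht, hb⟩ := hsep _ _ hle
    have key := realize_hom_eq_of_realize_eq h (v := fun _ => a) (hb.trans (hbot _).symm)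
    rw [hbot, ht] at key
    exact hle (le_top.trans (key.le.trans bot_le))
  · by_contra hle
    obtain ⟨t, ht, hb⟩ := hsep _ _ hle
    have key := realize_hom_eq_of_realize_eq h (v := fun _ => a) (ht.trans (htop _).symm)
    rw [htop, hb] at key
    exact hle (le_top.trans (key.ge.trans bot_le))
end

section
/- On the real unit interval [0,1], define x ⊕ y := min(x + y, 1) and x ⊙ y := max(x + y − 1, 0). Let A ⊆ [0,1] contain 0 and 1 and be closed under ⊕, ⊙, max and min. Then every function h : A → [0,1] satisfying h 0 = 0, h 1 = 1, h(a ⊕ b) = h a ⊕ h b, h(a ⊙ b) = h a ⊙ h b, h(max(a,b)) = max(h a, h b) and h(min(a,b)) = min(h a, h b) for all a, b ∈ A is the inclusion map: h a = a for all a ∈ A. -/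
/-- Truncated addition on the real unit interval. -/
noncomputable def oplus (x y : ℝ) : ℝ := min (x + y) 1

/-- Łukasiewicz conjunction on the real unit interval. -/
noncomputable def odot (x y : ℝ) : ℝ := max (x + y - 1) 0

/-- Doubling expands the distance between a point of `A` and its image by a factor of `2`. -/
lemma exists_abs_sub_eq_two_mul (A : Set ℝ)
    (hoplus : ∀ a ∈ A, ∀ b ∈ A, oplus a b ∈ A)
    (hodot : ∀ a ∈ A, ∀ b ∈ A, odot a b ∈ A)
    (h : ℝ → ℝ) (hh0 : h 0 = 0) (hh1 : h 1 = 1)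
    (hho : ∀ a ∈ A, ∀ b ∈ A, h (oplus a b) = oplus (h a) (h b))
    (hhd : ∀ a ∈ A, ∀ b ∈ A, h (odot a b) = odot (h a) (h b))
    {a : ℝ} (ha : a ∈ A) :
    ∃ b ∈ A, |h b - b| = 2 * |h a - a| := by
  have ho := hho a ha a ha
  have hd := hhd a ha a ha
  have abs_two_mul (x : ℝ) : |2 * x| = 2 * |x| := by simp [abs_mul]
  rcases le_total (a + a) 1 with hle | hle
  · refine ⟨oplus a a, hoplus a ha a ha, ?_⟩
    have hzero : odot a a = 0 := max_eq_right (by linarith)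
    rw [hzero, hh0] at hd
    have himage : h a + h a - 1 ≤ 0 := (le_max_left _ _).trans_eq hd.symm
    rw [ho, oplus, oplus, min_eq_left hle, min_eq_left (by linarith), ← abs_two_mul]
    congr 1
    ring
  · refine ⟨odot a a, hodot a ha a ha, ?_⟩
    have hone : oplus a a = 1 := min_eq_right hle
    rw [hone, hh1] at ho
    have himage : 1 ≤ h a + h a := ho.trans_le (min_le_left _ _)
    rw [hd, odot, odot, max_eq_left (by linarith), max_eq_left (by linarith), ← abs_two_mul]
    congr 1
    ring

/-- the standard positive MV-chain `[0,1]₊` has only trivial partial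
endomorphisms: any map `h` defined on a subset `A ⊆ [0,1]` containing `0` and `1` and
closed under `⊕`, `⊙`, `max`, `min` which preserves these operations and the constants
is the inclusion. -/
theorem stmt12 (A : Set ℝ) (hA : A ⊆ Set.Icc (0 : ℝ) 1)
    (h0 : (0 : ℝ) ∈ A) (h1 : (1 : ℝ) ∈ A)
    (hoplus : ∀ a ∈ A, ∀ b ∈ A, oplus a b ∈ A)
    (hodot : ∀ a ∈ A, ∀ b ∈ A, odot a b ∈ A)
    (hmax : ∀ a ∈ A, ∀ b ∈ A, max a b ∈ A)
    (hmin : ∀ a ∈ A, ∀ b ∈ A, min a b ∈ A)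
    (h : ℝ → ℝ) (hrange : ∀ a ∈ A, h a ∈ Set.Icc (0 : ℝ) 1)
    (hh0 : h 0 = 0) (hh1 : h 1 = 1)
    (hho : ∀ a ∈ A, ∀ b ∈ A, h (oplus a b) = oplus (h a) (h b))
    (hhd : ∀ a ∈ A, ∀ b ∈ A, h (odot a b) = odot (h a) (h b))
    (hhmax : ∀ a ∈ A, ∀ b ∈ A, h (max a b) = max (h a) (h b))
    (hhmin : ∀ a ∈ A, ∀ b ∈ A, h (min a b) = min (h a) (h b)) :
    ∀ a ∈ A, h a = a := by
  have bound (n : ℕ) : ∀ a ∈ A, |h a - a| ≤ (1 / 2) ^ n := by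
    induction n with
    | zero =>
      intro a ha
      obtain ⟨ha0, ha1⟩ := hA ha
      obtain ⟨hb0, hb1⟩ := hrange a ha
      rw [pow_zero, abs_le]
      constructor <;> linarith
    | succ n ih =>
      intro a ha
      obtain ⟨b, hb, hab⟩ :=
        exists_abs_sub_eq_two_mul A hoplus hodot h hh0 hh1 hho hhd ha
      have := ih b hb
      rw [pow_succ]
      linarith
  intro a ha
  have hlim := tendsto_pow_atTop_nhds_zero_of_lt_one (r := (1 / 2 : ℝ)) (by norm_num) (by norm_num)
  have hle : |h a - a| ≤ 0 := ge_of_tendsto' hlim fun n => bound n a ha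
  exact sub_eq_zero.mp (abs_nonpos_iff.mp hle)
end

section
/- Let X be a type and L a topological space carrying the discrete topology, and equip the space Ultrafilter X of ultrafilters on X with its standard (Stone–Čech) topology. Then the map sending a continuous function g : Ultrafilter X → L to g ∘ pure : X → L is a bijection from the set of continuous functions Ultrafilter X → L onto the set of functions X → L of finite range; in particular, every finite-range f : X → L has a unique continuous extension f♯ : Ultrafilter X → L with f♯ ∘ pure = f. Moreover, if L carries an L'-structure for a first-order language L' with no relation symbols, this bijection is an isomorphism of L'-structures between the substructure of continuous functions in the pointwise structure on (Ultrafilter X → L) and the substructure of finite-range functions in the pointwise structure on (X → L). -/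
open FirstOrder Language Structure

namespace Ultrafilter

theorem continuous_ext {X L : Type*} [TopologicalSpace L] [T2Space L]
    {g h : Ultrafilter X → L} (hg : Continuous g) (hh : Continuous h)
    (hgh : g ∘ pure = h ∘ pure) : g = h :=
  denseRange_pure.equalizer hg hh hgh

theorem finite_range_of_continuous {X L : Type*} [TopologicalSpace L] [DiscreteTopology L]
    {g : Ultrafilter X → L} (hg : Continuous g) : (Set.range g).Finite :=
  (isCompact_range hg).finite_of_discrete

theorem exists_continuous_extension_of_finite_range {X L : Type*} [TopologicalSpace L]
    [DiscreteTopology L] {f : X → L} (hf : (Set.range f).Finite) :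
    ∃ g : Ultrafilter X → L, Continuous g ∧ g ∘ pure = f := by
  have : Finite (Set.range f) := hf
  refine ⟨Subtype.val ∘ Ultrafilter.extend (Set.rangeFactorization f),
    continuous_subtype_val.comp (continuous_ultrafilter_extend _), ?_⟩
  rw [Function.comp_assoc, ultrafilter_extend_extends]
  rfl

theorem bijOn_comp_pure (X L : Type*) [TopologicalSpace L] [DiscreteTopology L] :
    Set.BijOn (fun g : Ultrafilter X → L => g ∘ pure)
      {g : Ultrafilter X → L | Continuous g} {f : X → L | (Set.range f).Finite} :=
  ⟨fun _ hg => (finite_range_of_continuous hg).subset (Set.range_comp_subset_range _ _),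
    fun _ hg _ hh hgh => continuous_ext hg hh hgh,
    fun _ hf => exists_continuous_extension_of_finite_range hf⟩

end Ultrafilter

/-- The substructure of continuous functions into a discrete structure. -/
def continuousSubstructure (L' : FirstOrder.Language) (Y L : Type*) [TopologicalSpace Y]
    [TopologicalSpace L] [DiscreteTopology L] [L'.Structure L] : L'.Substructure (Y → L) where
  carrier := {g | Continuous g}
  fun_mem {n} F v hv := by
    have h : Continuous fun y => fun i => v i y := continuous_pi hv
    exact (continuous_of_discreteTopology (f := fun w : Fin n → L => funMap F w)).comp h

/-- The substructure of functions of finite range. -/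
def finiteRangeSubstructure (L' : FirstOrder.Language) (X L : Type*) [L'.Structure L] :
    L'.Substructure (X → L) where
  carrier := {f | (Set.range f).Finite}
  fun_mem F v hv := by
    refine ((Set.Finite.pi hv).image (funMap F)).subset ?_
    rintro _ ⟨x, rfl⟩
    exact ⟨fun i => v i x, fun i _ => ⟨x, rfl⟩, rfl⟩

/-- Composition with `pure`, as an isomorphism from the continuous functions on `Ultrafilter X`
to the finite-range functions on `X`. -/
noncomputable def compPureEquiv (L' : FirstOrder.Language) [L'.IsAlgebraic] (X L : Type*)
    [TopologicalSpace L] [DiscreteTopology L] [L'.Structure L] :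
    continuousSubstructure L' (Ultrafilter X) L ≃[L'] finiteRangeSubstructure L' X L where
  toEquiv := (Ultrafilter.bijOn_comp_pure X L).equiv _
  map_fun' _ _ := rfl
  map_rel' r := isEmptyElim r

/-- composition with `pure` is a bijection from continuous functions
`Ultrafilter X → L` (with `L` discrete) onto finite-range functions `X → L`; every
finite-range function has a unique continuous extension to `Ultrafilter X`; and for an
algebraic first-order language `L'` this bijection is an isomorphism of `L'`-structures
between the substructure of continuous functions and the substructure of finite-range
functions. -/
theorem stmt13 {X L : Type*} [TopologicalSpace L] [DiscreteTopology L]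
    {L' : FirstOrder.Language} [L'.IsAlgebraic] [L'.Structure L] :
    Set.BijOn (fun g : Ultrafilter X → L => g ∘ pure)
      {g : Ultrafilter X → L | Continuous g} {f : X → L | (Set.range f).Finite} ∧
    (∀ f : X → L, (Set.range f).Finite →
      ∃! g : Ultrafilter X → L, Continuous g ∧ g ∘ pure = f) ∧
    (∃ (S : L'.Substructure (Ultrafilter X → L)) (T : L'.Substructure (X → L)),
      (S : Set (Ultrafilter X → L)) = {g : Ultrafilter X → L | Continuous g} ∧
      (T : Set (X → L)) = {f : X → L | (Set.range f).Finite} ∧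
      ∃ e : S ≃[L'] T, ∀ g : S, (e g : X → L) = (g : Ultrafilter X → L) ∘ pure) := by
  exact ⟨Ultrafilter.bijOn_comp_pure X L,
    fun f hf =>
      let ⟨g, hg, hgf⟩ := Ultrafilter.exists_continuous_extension_of_finite_range hf
      ⟨g, ⟨hg, hgf⟩, fun _ hh => Ultrafilter.continuous_ext hh.1 hg (hh.2.trans hgf.symm)⟩,
    continuousSubstructure L' (Ultrafilter X) L, finiteRangeSubstructure L' X L, rfl, rfl,
    compPureEquiv L' X L, fun _ => rfl⟩
end

section
/- Let L' be a first-order language with no relation symbols, M an L'-structure, X a type, and A a substructure of the pointwise L'-structure on (X → M) such that every member of A has finite range. Then for every finite subset S of A there exist a finite type Y and an L'-embedding of the substructure of A generated by S into the pointwise L'-structure on (Y → M). -/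
open FirstOrder Language Structure

universe v w

/-- Functions generated by `S` cannot separate points that `S` does not separate. -/
theorem apply_eq_of_mem_closure {L : FirstOrder.Language} {M : Type v} {X : Type w}
    [L.Structure M] {S : Set (X → M)} {x y : X} (hxy : ∀ s ∈ S, s x = s y)
    {f : X → M} (hf : f ∈ Substructure.closure L S) : f x = f y :=
  Substructure.closure_induction (p := fun f => f x = f y) hf hxy <| by
    intro n g v hv
    exact congrArg (funMap g) (funext hv)

/-- Restriction along `r : Y → X`, as an embedding of any substructure of `X → M` whose members
are determined by their values on the range of `r`. -/
def restrictEmbedding {L : FirstOrder.Language} [L.IsAlgebraic] {M X Y : Type*}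
    [L.Structure M] (B : L.Substructure (X → M)) (r : Y → X)
    (h : ∀ f ∈ B, ∀ g ∈ B, f ∘ r = g ∘ r → f = g) : B ↪[L] (Y → M) where
  toFun f := f.1 ∘ r
  inj' f g hfg := Subtype.ext (h f.1 f.2 g.1 g.2 hfg)
  map_fun' _ _ := rfl
  map_rel' R := isEmptyElim R

/-- Evaluation at points of `X` takes finitely many values on a finite set of functions of finite
range. -/
theorem finite_range_eval {M : Type v} {X : Type w} (S : Finset (X → M))
    (h : ∀ s ∈ S, (Set.range s).Finite) :
    (Set.range fun (x : X) (s : S) => s.1 x).Finite :=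
  (Set.Finite.pi' fun s : S => h s.1 s.2).subset <| by
    rintro _ ⟨x, rfl⟩ s
    exact ⟨x, rfl⟩

/-- if `A` is a substructure of `X → M` all of whose members have finite
range, then the substructure generated by any finite subset `S` of `A` embeds into a
power of `M` over a finite type. -/
theorem stmt14 {L : FirstOrder.Language} [L.IsAlgebraic] {M : Type v} {X : Type w}
    [L.Structure M] (A : L.Substructure (X → M))
    (hfin : ∀ f ∈ A, (Set.range f).Finite)
    (S : Finset (X → M)) (hS : ↑S ⊆ (A : Set (X → M))) :
    ∃ (Y : Type) (_ : Finite Y),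
      Nonempty ((Substructure.closure L (S : Set (X → M))) ↪[L] (Y → M)) := by
  let e : X → S → M := fun x s => s.1 x
  have : Finite (Set.range e) := finite_range_eval S fun s hs => hfin s (hS hs)
  obtain ⟨n, ⟨φ⟩⟩ := Finite.exists_equiv_fin (Set.range e)
  choose r hr using fun i => (φ.symm i).2
  refine ⟨Fin n, inferInstance, ⟨restrictEmbedding _ r fun f hf g hg hfg => funext fun x => ?_⟩⟩
  let i := φ ⟨e x, x, rfl⟩
  have hi : e (r i) = e x := by rw [hr, Equiv.symm_apply_apply]
  have hx : ∀ s ∈ (S : Set (X → M)), s (r i) = s x := fun s hs => congrFun hi ⟨s, hs⟩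
  rw [← apply_eq_of_mem_closure hx hf, ← apply_eq_of_mem_closure hx hg]
  exact congrFun hfg i
end

section
/- Let L' be a first-order language with no relation symbols, M an L'-structure, X a type, and A a substructure of the pointwise L'-structure on (X → M). Let H be the set of all L'-homomorphisms from A to M. Then the canonical map η : A → (H → M) defined by η a = (h ↦ h a) is an injective L'-homomorphism into the pointwise L'-structure on (H → M); in particular, the homomorphisms from A to M separate the elements of A: for all a ≠ b in A there is an L'-homomorphism h : A → M with h a ≠ h b. -/
open FirstOrder Language Structure

universe v w

namespace FirstOrder.Language

/-- Evaluation at a point is a homomorphism from the pointwise structure. -/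
def Hom.piEval (L : Language) {X M : Type*} [L.Structure M] (x : X) : (X → M) →[L] M where
  toFun a := a x
  map_fun' _ _ := rfl
  map_rel' _ _ hr := hr x

/-- The homomorphism into a power of `M` that sends a point to its evaluation on homomorphisms. -/
def Hom.doubleDual (L : Language) (A M : Type*) [L.Structure A] [L.Structure M] :
    A →[L] ((A →[L] M) → M) where
  toFun a h := h a
  map_fun' f v := funext fun h => h.map_fun f v
  map_rel' r v hr h := h.map_rel r v hr

theorem Substructure.exists_hom_ne {L : Language} {X M : Type*} [L.Structure M]
    (A : L.Substructure (X → M)) {a b : A} (hab : a ≠ b) : ∃ h : A →[L] M, h a ≠ h b := by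
  obtain ⟨x, hx⟩ := Function.ne_iff.mp (Subtype.coe_injective.ne hab)
  exact ⟨(Hom.piEval L x).comp A.subtype.toHom, hx⟩

end FirstOrder.Language

/-- for a substructure `A` of a power of `M`, the canonical map
`η : A → ((A →[L] M) → M)`, `η a = fun h => h a`, is an injective homomorphism into the
pointwise structure; in particular the homomorphisms `A →[L] M` separate the points
of `A`. -/
theorem stmt15 {L : FirstOrder.Language} [L.IsAlgebraic] {M : Type v} {X : Type w}
    [L.Structure M] (A : L.Substructure (X → M)) :
    (∃ η : A →[L] ((A →[L] M) → M),
      (∀ (a : A) (h : A →[L] M), η a h = h a) ∧ Function.Injective η) ∧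
    (∀ a b : A, a ≠ b → ∃ h : A →[L] M, h a ≠ h b) := by
  refine ⟨⟨Hom.doubleDual L A M, fun _ _ => rfl, fun a b hab => ?_⟩, fun a b => A.exists_hom_ne⟩
  by_contra hne
  obtain ⟨h, hh⟩ := A.exists_hom_ne hne
  exact hh (congrFun hab h)
end
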